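/- arXiv:2011.13750 — 3 statements merged into one kernel-verified Lean document; each statement's English description precedes it below -/
import Mathlib

section
/- Let s ≥ 1 and n be integers with 2^s < n ≤ 2^{s+1} and n ≥ 4. Then in A(2,n) ⊗_{ℤ/2} A(2,n) the product z(w_1)^{2^{s+1}−1} · z(w_2)^{ρ(n−1−2^s)−1} is nonzero. -/
open MvPolynomial TensorProduct

noncomputable section

/-- Weights for the grading: the variable `Sum.inl i` corresponds to the Stiefel-Whitney
class `w_{i+1}` (degree `i+1`), and `Sum.inr j` to the dual class `w̄_{j+1}` (degree `j+1`). -/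
def grassWt (k m : ℕ) : Fin k ⊕ Fin m → ℕ :=
  Sum.elim (fun i => (i : ℕ) + 1) (fun j => (j : ℕ) + 1)

/-- The relation `(1 + w_1 + ⋯ + w_k)·(1 + w̄_1 + ⋯ + w̄_m) - 1`. -/
def grassRel (k m : ℕ) : MvPolynomial (Fin k ⊕ Fin m) (ZMod 2) :=
  (1 + ∑ i : Fin k, X (Sum.inl i)) * (1 + ∑ j : Fin m, X (Sum.inr j)) - 1

/-- The ideal generated by the positive-degree weighted-homogeneous components of the relation. -/
def grassIdeal (k m : ℕ) : Ideal (MvPolynomial (Fin k ⊕ Fin m) (ZMod 2)) :=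
  Ideal.span { p | ∃ d : ℕ, 0 < d ∧
    p = weightedHomogeneousComponent (grassWt k m) d (grassRel k m) }

/-- `GrassCoh k m` is the ring `A(k, n)` with `m = n - k`, i.e. the mod 2 cohomology ring
of the Grassmannian `G_k(ℝ^{k+m})`. -/
abbrev GrassCoh (k m : ℕ) : Type :=
  MvPolynomial (Fin k ⊕ Fin m) (ZMod 2) ⧸ grassIdeal k m

/-- The Stiefel-Whitney class `w_{i+1}` in `A(k, k+m)`. -/
def sw (k m : ℕ) (i : Fin k) : GrassCoh k m :=
  Ideal.Quotient.mk (grassIdeal k m) (X (Sum.inl i))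

/-- `ρ m` : the smallest integral power of `2` that is strictly greater than `m`. -/
def rho (m : ℕ) : ℕ := 2 ^ m.size

/-- The multiplication map `μ : A(k,n) ⊗ A(k,n) → A(k,n)`. -/
def grassMul (k m : ℕ) : GrassCoh k m ⊗[ZMod 2] GrassCoh k m →ₗ[ZMod 2] GrassCoh k m :=
  LinearMap.mul' (ZMod 2) (GrassCoh k m)

/-- The basic zero-divisor `z(x) = x ⊗ 1 + 1 ⊗ x`. -/
def zd (k m : ℕ) (x : GrassCoh k m) : GrassCoh k m ⊗[ZMod 2] GrassCoh k m :=
  x ⊗ₜ 1 + 1 ⊗ₜ x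

/-- The set of lengths of nonzero products of zero-divisors; its greatest element is
the zero-divisor cup-length `zcl(k, k+m)`. -/
def zclSet (k m : ℕ) : Set ℕ :=
  { r : ℕ | ∃ f : Fin r → GrassCoh k m ⊗[ZMod 2] GrassCoh k m,
      (∀ i, f i ∈ LinearMap.ker (grassMul k m)) ∧ ∏ i, f i ≠ 0 }

lemma aux_two {C : Type*} [CommRing C] [Algebra (ZMod 2) C] (x : C) : x + x = 0 := by
  have : (2 : ZMod 2) • x = 0 := by
    rw [show (2 : ZMod 2) = 0 from rfl, zero_smul]
  rwa [two_smul] at this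

/-- The complete symmetric recurrence in characteristic two. -/
def auxRec {C : Type*} [CommRing C] (c1 c2 : C) : ℕ → C
  | 0 => 1
  | 1 => c1
  | k + 2 => c1 * auxRec c1 c2 (k + 1) + c2 * auxRec c1 c2 k

lemma auxRec_xy {C : Type*} [CommRing C] [Algebra (ZMod 2) C] (x y : C) (k : ℕ) :
    (x + y) * auxRec (x + y) (x * y) k = x ^ (k + 1) + y ^ (k + 1) ∧
    (x + y) * auxRec (x + y) (x * y) (k + 1) = x ^ (k + 2) + y ^ (k + 2) := by
  induction k with
  | zero =>
    refine ⟨by simp [auxRec], ?_⟩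
    simp only [auxRec]
    linear_combination aux_two (x * y)
  | succ k ih =>
    refine ⟨ih.2, ?_⟩
    rw [auxRec]
    linear_combination (x + y) * ih.2 + x * y * ih.1 +
      aux_two (x * y ^ (k + 2) + y * x ^ (k + 2))

lemma auxRec_form {C : Type*} [CommRing C] (c1 c2 : C) (l : ℕ) :
    (∃ p, auxRec c1 c2 (2 * l) = c2 ^ l + c1 ^ 2 * p) ∧
    (∃ q p, auxRec c1 c2 (2 * l + 1) = c1 * c2 ^ l * q + c1 ^ 2 * p) := by
  induction l with
  | zero => exact ⟨⟨0, by simp [auxRec]⟩, ⟨1, 0, by simp [auxRec]⟩⟩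
  | succ l ih =>
    obtain ⟨⟨p, hp⟩, q, p', hq⟩ := ih
    have e : auxRec c1 c2 (2 * (l + 1)) =
        c2 ^ (l + 1) + c1 ^ 2 * (c2 ^ l * q + c1 * p' + c2 * p) := by
      rw [show 2 * (l + 1) = 2 * l + 2 by ring, auxRec, hp, hq]; ring
    refine ⟨⟨_, e⟩, 1 + q, c1 * (c2 ^ l * q + c1 * p' + c2 * p) + c2 * p', ?_⟩
    rw [show 2 * (l + 1) + 1 = (2 * l + 1) + 2 by ring, auxRec,
      show 2 * l + 1 + 1 = 2 * (l + 1) by ring, e, hq]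
    ring

lemma auxRec_mem {C : Type*} [CommRing C] (c1 c2 : C) (b k : ℕ) (hk : 2 * b + 2 ≤ k) :
    ∃ p q, auxRec c1 c2 k = c2 ^ (b + 1) * p + c1 ^ 2 * q := by
  obtain ⟨l, hl⟩ : ∃ l, k / 2 = b + 1 + l := ⟨k / 2 - (b + 1), by omega⟩
  obtain ⟨⟨p, hp⟩, q, p', hq⟩ := auxRec_form c1 c2 (k / 2)
  rcases Nat.mod_two_eq_zero_or_one k with h | h
  · refine ⟨c2 ^ l, p, ?_⟩
    rw [show 2 * (k / 2) = k by omega] at hp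
    rw [hp, hl]; ring
  · refine ⟨c1 * c2 ^ l * q, p', ?_⟩
    rw [show 2 * (k / 2) + 1 = k by omega] at hq
    rw [hq, hl]; ring

/-- Evaluation of weighted homogeneous components via a grading variable. -/
lemma aux_whc {C : Type*} [CommRing C] [Algebra (ZMod 2) C] {σ : Type*} (wt : σ → ℕ)
    (c : σ → C) (d : ℕ) (p : MvPolynomial σ (ZMod 2)) :
    aeval c (weightedHomogeneousComponent wt d p) =
      (aeval (fun v => Polynomial.C (c v) * Polynomial.X ^ wt v :
        σ → Polynomial C) p).coeff d := by
  classical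
  induction p using MvPolynomial.induction_on' with
  | monomial u a =>
    have hG : (aeval (fun v => Polynomial.C (c v) * Polynomial.X ^ wt v :
        σ → Polynomial C) (monomial u a)) =
        Polynomial.C (aeval c (monomial u a)) * Polynomial.X ^ (Finsupp.weight wt u) := by
      rw [aeval_monomial, aeval_monomial]
      simp only [Finsupp.prod, mul_pow, Finset.prod_mul_distrib, map_mul, map_prod, map_pow]
      rw [Finsupp.weight_apply, Finsupp.sum, ← Finset.prod_pow_eq_pow_sum, mul_assoc]
      congr 1
      congr 1
      refine Finset.prod_congr rfl fun i _ => ?_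
      rw [← pow_mul, smul_eq_mul, mul_comm]
    rw [hG, Polynomial.coeff_C_mul_X_pow]
    by_cases h : d = Finsupp.weight wt u
    · rw [if_pos h, weightedHomogeneousComponent_of_mem
        (isWeightedHomogeneous_monomial wt u a h.symm), if_pos rfl]
    · rw [if_neg h, weightedHomogeneousComponent_of_mem
        (isWeightedHomogeneous_monomial wt u a rfl), if_neg h, map_zero]
  | add p q hp hq => simp [hp, hq]

/-- Functionals on the cohomology ring from recurrences. -/
lemma aux_functional {C M : Type*} [CommRing C] [Algebra (ZMod 2) C]
    [AddCommGroup M] [Module (ZMod 2) M] (m : ℕ)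
    (c1 c2 : C) (h : ℕ → C) (h0 : h 0 = 1) (h1 : h 1 = c1)
    (hr : ∀ k, h (k + 2) = c1 * h (k + 1) + c2 * h k)
    (l : C →ₗ[ZMod 2] M) (hl1 : ∀ g, l (g * h (m + 1)) = 0)
    (hl2 : ∀ g, l (g * h (m + 2)) = 0) :
    ∃ ψ : GrassCoh 2 m →ₗ[ZMod 2] M,
      ∀ i j, ψ (sw 2 m 0 ^ i * sw 2 m 1 ^ j) = l (c1 ^ i * c2 ^ j) := by
  classical
  have two : ∀ x : C, x + x = 0 := aux_two
  let c : Fin 2 ⊕ Fin m → C := Sum.elim (fun i => if i = 0 then c1 else c2) (fun j => h (j + 1))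
  let F : MvPolynomial (Fin 2 ⊕ Fin m) (ZMod 2) →ₐ[ZMod 2] C := aeval c
  let J : Ideal C := Ideal.span {h (m + 1), h (m + 2)}
  have hJ : ∀ x ∈ J, l x = 0 := by
    intro x hx
    obtain ⟨a, b, rfl⟩ := Ideal.mem_span_pair.1 hx
    rw [map_add, hl1, hl2, add_zero]
  have J1 : h (m + 1) ∈ J := Ideal.subset_span (by simp)
  have J2 : h (m + 2) ∈ J := Ideal.subset_span (by simp)
  have hF : grassIdeal 2 m ≤ J.comap F := by
    rw [grassIdeal, Ideal.span_le]
    rintro p ⟨d, hd, rfl⟩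
    change F _ ∈ J
    simp only [F]
    rw [aux_whc]
    let g : ℕ → C := fun k => if k ≤ m then h k else 0
    let Q : Polynomial C := 1 + ∑ j : Fin m, Polynomial.C (h (j + 1)) * Polynomial.X ^ ((j : ℕ) + 1)
    have hQ : ∀ k, Q.coeff k = g k := by
      intro k
      simp only [Q, g, Polynomial.coeff_add, Polynomial.finsetSum_coeff,
        Polynomial.coeff_C_mul_X_pow, Polynomial.coeff_one]
      rw [Fin.sum_univ_eq_sum_range (fun j => if k = j + 1 then h (j + 1) else 0) m]
      rcases k with _ | k
      · simp [h0]
      · simp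
    have hrel : (aeval (fun v => Polynomial.C (c v) * Polynomial.X ^ grassWt 2 m v :
        _ → Polynomial C) (grassRel 2 m)) =
        Q + Polynomial.C c1 * (Polynomial.X * Q) + Polynomial.C c2 * (Polynomial.X ^ 2 * Q) - 1 := by
      simp [grassRel, Fin.sum_univ_two, grassWt, c, Q]
      ring
    rw [hrel]
    obtain ⟨e, rfl⟩ : ∃ e, d = e + 1 := ⟨d - 1, by omega⟩
    rcases e with _ | e
    · simp only [Polynomial.coeff_sub, Polynomial.coeff_add, Polynomial.coeff_C_mul, hQ,
        Polynomial.coeff_X_mul, Polynomial.coeff_one, Polynomial.coeff_X_pow_mul']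
      simp only [g]
      rcases m with _ | m
      · simpa [h0, h1] using J1
      · simp [h0, h1, two]
    · have e1 : (Polynomial.X ^ 2 * Q).coeff (e + 1 + 1) = g e := by
        rw [show e + 1 + 1 = e + 2 from rfl, Polynomial.coeff_X_pow_mul, hQ]
      simp only [Polynomial.coeff_sub, Polynomial.coeff_add, Polynomial.coeff_C_mul, hQ,
        Polynomial.coeff_X_mul, Polynomial.coeff_one, e1]
      have hre := hr e
      simp only [g]
      rcases lt_trichotomy (e + 1) m with hlt | heq | hgt
      · have : h (e + 1 + 1) + c1 * h (e + 1) + c2 * h e = 0 := by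
          rw [add_assoc, ← hre]; exact two _
        rw [if_pos (by omega), if_pos (by omega), if_pos (by omega), this]
        simp
      · rw [if_neg (by omega), if_pos (by omega), if_pos (by omega), zero_add, ← hre]
        subst heq
        simpa using J1
      · by_cases he : e = m
        · subst he
          rw [if_neg (by omega), if_neg (by omega), if_pos (by omega)]
          have : c2 * h e = h (e + 2) + c1 * h (e + 1) := by
            rw [hre]
            linear_combination - two (c1 * h (e + 1))
          simp only [mul_zero, add_zero, zero_add, this]
          simpa using J.add_mem J2 (J.mul_mem_left c1 J1)
        · rw [if_neg (by omega), if_neg (by omega), if_neg (by omega)]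
          simp
  refine ⟨Submodule.liftQ ((grassIdeal 2 m).restrictScalars (ZMod 2)) (l ∘ₗ F.toLinearMap) ?_, ?_⟩
  · intro x hx
    exact hJ _ (hF hx)
  · intro i j
    have : sw 2 m 0 ^ i * sw 2 m 1 ^ j = Ideal.Quotient.mk (grassIdeal 2 m)
        (X (Sum.inl 0) ^ i * X (Sum.inl 1) ^ j) := by
      simp [sw]
    rw [this]
    change l (F _) = _
    simp [F, c]

lemma aux_choose (k i : ℕ) (hi : i ≤ 2 ^ k - 1) : (((2 ^ k - 1).choose i : ℕ) : ZMod 2) = 1 := by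
  induction i with
  | zero => simp
  | succ i ih =>
    have h := ih (by omega)
    have e : (2 ^ k).choose (i + 1) = (2 ^ k - 1).choose i + (2 ^ k - 1).choose (i + 1) := by
      obtain ⟨N, hN⟩ : ∃ N, 2 ^ k = N + 1 := ⟨2 ^ k - 1, by have := Nat.one_le_two_pow (n := k); omega⟩
      rw [hN, Nat.choose_succ_succ, Nat.add_sub_cancel]
    have d : 2 ∣ (2 ^ k).choose (i + 1) :=
      Nat.prime_two.dvd_choose_pow (by omega) (by omega)
    have d' : (((2 ^ k).choose (i + 1) : ℕ) : ZMod 2) = 0 := (ZMod.natCast_eq_zero_iff _ _).2 d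
    rw [e, Nat.cast_add, h] at d'
    generalize (((2 ^ k - 1).choose (i + 1) : ℕ) : ZMod 2) = z at *
    revert z
    decide

/-- Top-degree functional. -/
lemma aux_phi (K : Type*) [CommRing K] [Algebra (ZMod 2) K] (s n : ℕ) (h1 : 2 ^ s < n) (h4 : 4 ≤ n) :
    ∃ φ : GrassCoh 2 (n - 2) →ₗ[ZMod 2] K,
      φ (sw 2 (n - 2) 0 ^ (2 ^ (s + 1) - 2) * sw 2 (n - 2) 1 ^ (n - 1 - 2 ^ s)) = 1 := by
  let x : Polynomial (Polynomial K) := Polynomial.C Polynomial.X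
  let y : Polynomial (Polynomial K) := Polynomial.X
  let h : ℕ → Polynomial (Polynomial K) := auxRec (x + y) (x * y)
  have hxy : ∀ k, (x + y) * h k = x ^ (k + 1) + y ^ (k + 1) := fun k => (auxRec_xy x y k).1
  let l0 : Polynomial (Polynomial K) →ₗ[ZMod 2] K :=
    (Polynomial.lcoeff K (n - 1)).restrictScalars (ZMod 2) ∘ₗ
      ((Polynomial.lcoeff (Polynomial K) (n - 1)).restrictScalars (ZMod 2))
  let l : Polynomial (Polynomial K) →ₗ[ZMod 2] K :=
    l0 ∘ₗ LinearMap.mulLeft (ZMod 2) (x * (x + y))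
  have hl : ∀ f, l f = ((x * (x + y) * f).coeff (n - 1)).coeff (n - 1) := fun f => rfl
  have hkill : ∀ g k, n ≤ k + 1 → l (g * h k) = 0 := by
    intro g k hk
    have : x * (x + y) * (g * h k) =
        Polynomial.C (Polynomial.X ^ (k + 1)) * (x * g) + (x * g) * Polynomial.X ^ (k + 1) := by
      have e := hxy k
      have : x ^ (k + 1) = Polynomial.C (Polynomial.X ^ (k + 1)) := by simp [x]
      rw [← this]
      change _ = x ^ (k + 1) * (x * g) + (x * g) * y ^ (k + 1)
      linear_combination x * g * e
    rw [hl, this, Polynomial.coeff_add, Polynomial.coeff_C_mul, Polynomial.coeff_mul_X_pow',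
      if_neg (by omega), add_zero, Polynomial.coeff_X_pow_mul', if_neg (by omega)]
  obtain ⟨φ, hφ⟩ := aux_functional (n - 2) (x + y) (x * y) h rfl rfl (fun k => rfl)
    l (fun g => hkill g _ (by omega)) (fun g => hkill g _ (by omega))
  refine ⟨φ, ?_⟩
  rw [hφ, hl]
  have hp : 2 ^ (s + 1) = 2 * 2 ^ s := by ring
  have hp1 := Nat.one_le_two_pow (n := s)
  obtain ⟨m, hm⟩ : ∃ m, n - 1 - 2 ^ s = m := ⟨_, rfl⟩
  rw [hm]
  have : x * (x + y) * ((x + y) ^ (2 ^ (s + 1) - 2) * (x * y) ^ m) =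
      Polynomial.C (Polynomial.X ^ (m + 1)) *
        ((Polynomial.X + Polynomial.C Polynomial.X) ^ (2 ^ (s + 1) - 1) * Polynomial.X ^ m) := by
    rw [show 2 ^ (s + 1) - 1 = (2 ^ (s + 1) - 2) + 1 by omega, map_pow]
    change _ = x ^ (m + 1) * ((y + x) ^ _ * y ^ m)
    ring
  have hch : (((2 ^ (s + 1) - 1).choose (n - 1 - m) : ℕ) : K) = 1 := by
    have := congrArg (algebraMap (ZMod 2) K) (aux_choose (s + 1) (n - 1 - m) (by omega))
    simpa using this
  rw [this, Polynomial.coeff_C_mul, Polynomial.coeff_mul_X_pow', if_pos (by omega),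
    Polynomial.coeff_X_add_C_pow, ← mul_assoc, ← pow_add, Polynomial.coeff_mul_natCast,
    hch, Polynomial.coeff_X_pow, if_pos (by omega), mul_one]

/-- Low-degree functional. -/
lemma aux_psi (K : Type*) [CommRing K] [Algebra (ZMod 2) K] (m b : ℕ) (hb : 2 * b + 1 ≤ m) :
    ∃ ψ : GrassCoh 2 m →ₗ[ZMod 2] K,
      ∀ i j, ψ (sw 2 m 0 ^ i * sw 2 m 1 ^ j) = if i = 1 ∧ j = b then 1 else 0 := by
  let l : Polynomial (Polynomial K) →ₗ[ZMod 2] K :=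
    (Polynomial.lcoeff K b).restrictScalars (ZMod 2) ∘ₗ
      ((Polynomial.lcoeff (Polynomial K) 1).restrictScalars (ZMod 2))
  have hl : ∀ f, l f = (f.coeff 1).coeff b := fun f => rfl
  have hkill : ∀ g k, 2 * b + 2 ≤ k →
      l (g * auxRec (Polynomial.X : Polynomial (Polynomial K)) (Polynomial.C Polynomial.X) k) = 0 := by
    intro g k hk
    obtain ⟨p, q, e⟩ := auxRec_mem (Polynomial.X : Polynomial (Polynomial K))
      (Polynomial.C Polynomial.X) b k hk
    have : g * auxRec (Polynomial.X : Polynomial (Polynomial K)) (Polynomial.C Polynomial.X) k =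
        Polynomial.C (Polynomial.X ^ (b + 1)) * (g * p) + Polynomial.X ^ 2 * (g * q) := by
      rw [e, map_pow]; ring
    rw [hl, this, Polynomial.coeff_add, Polynomial.coeff_C_mul, Polynomial.coeff_X_pow_mul',
      if_neg (by omega), add_zero, Polynomial.coeff_X_pow_mul', if_neg (by omega)]
  obtain ⟨ψ, hψ⟩ := aux_functional m (Polynomial.X : Polynomial (Polynomial K))
    (Polynomial.C Polynomial.X) (auxRec Polynomial.X (Polynomial.C Polynomial.X))
    rfl rfl (fun k => rfl) l (fun g => hkill g _ (by omega)) (fun g => hkill g _ (by omega))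
  refine ⟨ψ, fun i j => ?_⟩
  rw [hψ, hl, ← map_pow, Polynomial.coeff_mul_C, Polynomial.coeff_X_pow]
  by_cases hi : 1 = i
  · subst hi
    simp [Polynomial.coeff_X_pow, eq_comm]
  · rw [if_neg hi, zero_mul, Polynomial.coeff_zero, if_neg (by omega)]

/-- Evaluating a pair of functionals on the product of zero-divisors. -/
lemma aux_eval {A : Type*} [CommRing A] [Algebra (ZMod 2) A] (w1 w2 : A)
    (φ ψ : A →ₗ[ZMod 2] ZMod 2) (s t m : ℕ) (hm : m < 2 ^ t)
    (hφ : φ (w1 ^ (2 ^ (s + 1) - 2) * w2 ^ m) = 1)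
    (hψ : ∀ i j, ψ (w1 ^ i * w2 ^ j) = if i = 1 ∧ j = 2 ^ t - 1 - m then 1 else 0) :
    (w1 ⊗ₜ[ZMod 2] (1 : A) + (1 : A) ⊗ₜ[ZMod 2] w1) ^ (2 ^ (s + 1) - 1) *
      (w2 ⊗ₜ[ZMod 2] (1 : A) + (1 : A) ⊗ₜ[ZMod 2] w2) ^ (2 ^ t - 1) ≠ 0 := by
  have hp : 2 ^ (s + 1) = 2 * 2 ^ s := by ring
  have hp1 := Nat.one_le_two_pow (n := s)
  intro hzero
  have key := congrArg (fun z => LinearMap.mul' (ZMod 2) (ZMod 2) (TensorProduct.map φ ψ z)) hzero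
  simp only [map_zero] at key
  rw [add_pow, add_pow, Finset.sum_mul_sum] at key
  simp only [Algebra.TensorProduct.tmul_pow, one_pow, Algebra.TensorProduct.tmul_mul_tmul,
    one_mul, mul_one] at key
  have key2 : ∀ i j, LinearMap.mul' (ZMod 2) (ZMod 2) (TensorProduct.map φ ψ
      (((w1 ^ i) ⊗ₜ[ZMod 2] (w1 ^ (2 ^ (s + 1) - 1 - i)) *
        (((2 ^ (s + 1) - 1).choose i : ℕ) : A ⊗[ZMod 2] A)) *
       ((w2 ^ j) ⊗ₜ[ZMod 2] (w2 ^ (2 ^ t - 1 - j)) *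
        (((2 ^ t - 1).choose j : ℕ) : A ⊗[ZMod 2] A)))) =
      (((2 ^ (s + 1) - 1).choose i : ℕ) : ZMod 2) * (((2 ^ t - 1).choose j : ℕ) : ZMod 2) *
      (φ (w1 ^ i * w2 ^ j) *
        (if 2 ^ (s + 1) - 1 - i = 1 ∧ 2 ^ t - 1 - j = 2 ^ t - 1 - m then 1 else 0)) := by
    intro i j
    rw [← hψ, mul_mul_mul_comm, Algebra.TensorProduct.tmul_mul_tmul, ← Nat.cast_mul, mul_comm,
      ← nsmul_eq_mul, map_nsmul, map_nsmul, TensorProduct.map_tmul, LinearMap.mul'_apply,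
      nsmul_eq_mul, Nat.cast_mul]
  simp only [map_sum, key2] at key
  rw [Finset.sum_eq_single (2 ^ (s + 1) - 2), Finset.sum_eq_single m] at key
  · rw [hφ, aux_choose _ _ (by omega), aux_choose _ _ (by omega), if_pos (by omega)] at key
    simp at key
  · intro j hj hne
    rw [Finset.mem_range] at hj
    rw [if_neg (by omega)]; simp
  · intro hj; exact absurd (Finset.mem_range.2 (by omega)) hj
  · intro i hi hne
    rw [Finset.mem_range] at hi
    refine Finset.sum_eq_zero fun j hj => ?_
    rw [if_neg (by omega)]; simp
  · intro hj; exact absurd (Finset.mem_range.2 (by omega)) hj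

/-- If `2^s < n ≤ 2^{s+1}`, `n ≥ 4`, then in `A(2,n) ⊗ A(2,n)` the product
`z(w_1)^{2^{s+1}-1} · z(w_2)^{ρ(n-1-2^s)-1}` is nonzero. -/
theorem g2n_zd_nonzero (s n : ℕ) (hs : 1 ≤ s) (h1 : 2 ^ s < n) (h2 : n ≤ 2 ^ (s + 1))
    (h4 : 4 ≤ n) :
    zd 2 (n - 2) (sw 2 (n - 2) 0) ^ (2 ^ (s + 1) - 1) *
      zd 2 (n - 2) (sw 2 (n - 2) 1) ^ (rho (n - 1 - 2 ^ s) - 1) ≠ 0 := by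
  have hp : 2 ^ (s + 1) = 2 * 2 ^ s := by ring
  have hp1 := Nat.one_le_two_pow (n := s)
  obtain ⟨φ, hφ⟩ := aux_phi (ZMod 2) s n h1 h4
  obtain ⟨m, hm⟩ : ∃ m, n - 1 - 2 ^ s = m := ⟨_, rfl⟩
  rw [hm] at hφ ⊢
  have hmR : m < 2 ^ m.size := Nat.lt_size_self m
  have hb : 2 * (2 ^ m.size - 1 - m) + 1 ≤ n - 2 := by
    have ht : m.size ≤ s := Nat.size_le.2 (by omega)
    have ht2 : 2 ^ m.size ≤ 2 ^ s := Nat.pow_le_pow_right (by norm_num) ht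
    rcases Nat.eq_zero_or_pos m with h0 | h0
    · subst h0; simp; omega
    · have hpos : 0 < m.size := Nat.size_pos.2 h0
      have : 2 ^ (m.size - 1) ≤ m := Nat.lt_size.1 (by omega)
      have e : 2 ^ m.size = 2 * 2 ^ (m.size - 1) := by
        rw [← pow_succ']; congr 1; omega
      omega
  obtain ⟨ψ, hψ⟩ := aux_psi (ZMod 2) (n - 2) _ hb
  exact aux_eval (sw 2 (n - 2) 0) (sw 2 (n - 2) 1) φ ψ s m.size m hmR hφ hψ
end
end

section
/- Let s, k, n be integers with 4 ≤ k ≤ 2^{s−1} and 2^s + k ≤ n ≤ 2^{s+1}. Then in A(k,n) ⊗_{ℤ/2} A(k,n) the product z(w_1)^{2^{s+1}−1} · z(w_2)^{2^{s+1}−1} is nonzero; consequently the zero-divisor cup-length zcl(k,n) is at least 4·2^s − 2. -/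
open MvPolynomial TensorProduct

noncomputable section

set_option linter.unusedSimpArgs false

/-- Scaled substitution reads off weighted homogeneous components. -/
theorem coeff_scaled_aeval {R : Type} [CommRing R] [Algebra (ZMod 2) R] {σ : Type} [Fintype σ]
    (wt : σ → ℕ) (v : σ → R) (d : ℕ) (p : MvPolynomial σ (ZMod 2)) :
    (aeval (fun i => Polynomial.C (v i) * Polynomial.X ^ wt i) p : Polynomial R).coeff d =
      aeval v (weightedHomogeneousComponent wt d p) := by
  classical
  induction p using MvPolynomial.induction_on' with
  | monomial m c =>
    have h1 : (aeval (fun i => Polynomial.C (v i) * Polynomial.X ^ wt i) (monomial m c) :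
        Polynomial R) = Polynomial.C (aeval v (monomial m c)) *
          Polynomial.X ^ (Finsupp.weight wt m) := by
      rw [aeval_monomial, aeval_monomial, Finsupp.prod_fintype _ _ (by simp),
        Finsupp.prod_fintype _ _ (by simp), Finsupp.weight_apply,
        Finsupp.sum_fintype _ _ (by simp)]
      simp only [mul_pow, Finset.prod_mul_distrib, ← pow_mul, Finset.prod_pow_eq_pow_sum, map_mul,
        map_prod, map_pow, smul_eq_mul]
      have hs : ∑ i, wt i * m i = ∑ i, m i * wt i :=
        Finset.sum_congr rfl fun i _ => Nat.mul_comm _ _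
      rw [hs, mul_assoc, Polynomial.algebraMap_apply]
    rw [h1, weightedHomogeneousComponent_of_mem (n := Finsupp.weight wt m)
      (isWeightedHomogeneous_monomial wt m c rfl), Polynomial.coeff_C_mul, Polynomial.coeff_X_pow]
    split_ifs <;> simp
  | add p q hp hq => simp [hp, hq]

/-- Ring homomorphisms out of `GrassCoh`. -/
theorem exists_grassHom {R : Type} [CommRing R] [Algebra (ZMod 2) R] (k m : ℕ)
    (e h : ℕ → R)
    (H : (1 + ∑ i : Fin k, Polynomial.C (e (i + 1)) * Polynomial.X ^ ((i : ℕ) + 1)) *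
      (1 + ∑ j : Fin m, Polynomial.C (h (j + 1)) * Polynomial.X ^ ((j : ℕ) + 1)) = 1) :
    ∃ Φ : GrassCoh k m →ₐ[ZMod 2] R, ∀ i : Fin k, Φ (sw k m i) = e (i + 1) := by
  let v : Fin k ⊕ Fin m → R := Sum.elim (fun i => e (i + 1)) (fun j => h (j + 1))
  have key : ∀ a ∈ grassIdeal k m, aeval v a = 0 := by
    intro a ha
    have : grassIdeal k m ≤ RingHom.ker (aeval v : _ →ₐ[ZMod 2] R) := by
      unfold grassIdeal
      rw [Ideal.span_le]
      rintro _ ⟨d, hd, rfl⟩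
      rw [SetLike.mem_coe, RingHom.mem_ker]
      rw [← coeff_scaled_aeval]
      have : (aeval (fun i => Polynomial.C (v i) * Polynomial.X ^ grassWt k m i)
          (grassRel k m) : Polynomial R) = 0 := by
        unfold grassRel
        simp only [map_sub, map_mul, map_add, map_one, map_sum, aeval_X]
        simpa [v, grassWt, sub_eq_zero] using H
      simp [this]
    exact this ha
  refine ⟨Ideal.Quotient.liftₐ _ (aeval v) key, fun i => ?_⟩
  change aeval v (X (Sum.inl i)) = _
  simp [v]

abbrev P4 := MvPolynomial (Fin 4) (ZMod 2)

/-- The Vandermonde product. -/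
def vdm : P4 := (X 0 - X 1) * ((X 0 - X 2) * ((X 0 - X 3) * ((X 1 - X 2) * ((X 1 - X 3) *
  (X 2 - X 3)))))

def idJ (N : ℕ) : Ideal P4 :=
  Ideal.span ((fun s => monomial s (1 : ZMod 2)) '' Set.range (fun i => Finsupp.single i N))

def idI (N : ℕ) : Ideal P4 := Submodule.comap (LinearMap.mulLeft P4 vdm) (idJ N)

theorem mem_idI {N : ℕ} {f : P4} : f ∈ idI N ↔ vdm * f ∈ idJ N := Iff.rfl

theorem X_pow_mem_idJ (i : Fin 4) {N a : ℕ} (h : N ≤ a) : (X i ^ a : P4) ∈ idJ N := by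
  have : (X i ^ N : P4) ∈ idJ N := by
    apply Ideal.subset_span
    exact ⟨_, ⟨i, rfl⟩, by simp [X_pow_eq_monomial]⟩
  obtain ⟨c, rfl⟩ := Nat.exists_eq_add_of_le h
  rw [pow_add]
  exact Ideal.mul_mem_right _ _ this

/-- The polynomial `∏ (1 - x_i t)`. -/
def ePoly : Polynomial P4 := (1 - Polynomial.C (X 0) * Polynomial.X) *
  (1 - Polynomial.C (X 1) * Polynomial.X) * (1 - Polynomial.C (X 2) * Polynomial.X) *
  (1 - Polynomial.C (X 3) * Polynomial.X)

/-- geometric series `1 / (1 - x_i t)`. -/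
def geo (i : Fin 4) : PowerSeries P4 := PowerSeries.mk fun n => X i ^ n

theorem geo_mul (i : Fin 4) : (1 - PowerSeries.C (X i) * PowerSeries.X) * geo i = 1 := by
  ext n
  rw [sub_mul, one_mul, mul_assoc, map_sub, PowerSeries.coeff_C_mul]
  cases n with
  | zero => simp [geo]
  | succ n => simp [geo, PowerSeries.coeff_succ_X_mul, PowerSeries.coeff_one, pow_succ']

def hSer : PowerSeries P4 := geo 0 * geo 1 * geo 2 * geo 3

theorem ePoly_hSer : (ePoly : PowerSeries P4) * hSer = 1 := by
  have h0 := geo_mul 0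
  have h1 := geo_mul 1
  have h2 := geo_mul 2
  have h3 := geo_mul 3
  have : (ePoly : PowerSeries P4) = (1 - PowerSeries.C (X 0) * PowerSeries.X) *
    (1 - PowerSeries.C (X 1) * PowerSeries.X) * (1 - PowerSeries.C (X 2) * PowerSeries.X) *
    (1 - PowerSeries.C (X 3) * PowerSeries.X) := by
    simp [ePoly]
  rw [this, hSer]
  calc _ = ((1 - PowerSeries.C (X 0) * PowerSeries.X) * geo 0) *
      ((1 - PowerSeries.C (X 1) * PowerSeries.X) * geo 1) *
      ((1 - PowerSeries.C (X 2) * PowerSeries.X) * geo 2) *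
      ((1 - PowerSeries.C (X 3) * PowerSeries.X) * geo 3) := by ring
    _ = 1 := by rw [h0, h1, h2, h3]; simp

theorem vdm_hSer : PowerSeries.C vdm * hSer =
    PowerSeries.C (X 0 ^ 3 * ((X 1 - X 2) * (X 1 - X 3) * (X 2 - X 3))) * geo 0
    - PowerSeries.C (X 1 ^ 3 * ((X 0 - X 2) * (X 0 - X 3) * (X 2 - X 3))) * geo 1
    + PowerSeries.C (X 2 ^ 3 * ((X 0 - X 1) * (X 0 - X 3) * (X 1 - X 3))) * geo 2
    - PowerSeries.C (X 3 ^ 3 * ((X 0 - X 1) * (X 0 - X 2) * (X 1 - X 2))) * geo 3 := by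
  have h0 := geo_mul 0
  have h1 := geo_mul 1
  have h2 := geo_mul 2
  have h3 := geo_mul 3
  simp only [vdm, hSer, map_mul, map_sub, map_pow]
  generalize geo 0 = g0 at *
  generalize geo 1 = g1 at *
  generalize geo 2 = g2 at *
  generalize geo 3 = g3 at *
  generalize (PowerSeries.C (X 0 : P4)) = x0 at *
  generalize (PowerSeries.C (X 1 : P4)) = x1 at *
  generalize (PowerSeries.C (X 2 : P4)) = x2 at *
  generalize (PowerSeries.C (X 3 : P4)) = x3 at *
  generalize (PowerSeries.X : PowerSeries P4) = t at *
  -- each `g_i` on the right is multiplied by the other `(1 - x_j t) g_j = 1`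
  calc _ = (x0 ^ 3 * ((x1 - x2) * (x1 - x3) * (x2 - x3))) * g0 *
        (((1 - x1 * t) * g1) * ((1 - x2 * t) * g2) * ((1 - x3 * t) * g3))
    - (x1 ^ 3 * ((x0 - x2) * (x0 - x3) * (x2 - x3))) * g1 *
        (((1 - x0 * t) * g0) * ((1 - x2 * t) * g2) * ((1 - x3 * t) * g3))
    + (x2 ^ 3 * ((x0 - x1) * (x0 - x3) * (x1 - x3))) * g2 *
        (((1 - x1 * t) * g1) * ((1 - x0 * t) * g0) * ((1 - x3 * t) * g3))
    - (x3 ^ 3 * ((x0 - x1) * (x0 - x2) * (x1 - x2))) * g3 *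
        (((1 - x1 * t) * g1) * ((1 - x2 * t) * g2) * ((1 - x0 * t) * g0)) := by ring
    _ = _ := by rw [h0, h1, h2, h3]; ring

theorem hSer_mem (S j : ℕ) (hj : S < j) : PowerSeries.coeff j hSer ∈ idI (S + 4) := by
  rw [mem_idI, ← PowerSeries.coeff_C_mul, vdm_hSer]
  simp only [map_add, map_sub, PowerSeries.coeff_C_mul, geo, PowerSeries.coeff_mk]
  have aux : ∀ (i : Fin 4) (g : P4), X i ^ 3 * g * X i ^ j ∈ idJ (S + 4) := by
    intro i g
    have : X i ^ 3 * g * X i ^ j = g * X i ^ (j + 3) := by ring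
    rw [this]
    exact Ideal.mul_mem_left _ _ (X_pow_mem_idJ i (by omega))
  exact sub_mem (add_mem (sub_mem (aux _ _) (aux _ _)) (aux _ _)) (aux _ _)

def ee1 : P4 := X 0 + X 1 + X 2 + X 3
def ee2 : P4 := X 0 * X 1 + X 0 * X 2 + X 0 * X 3 + X 1 * X 2 + X 1 * X 3 + X 2 * X 3

theorem ePoly_eq : ePoly = 1 + Polynomial.C ee1 * Polynomial.X + Polynomial.C ee2 * Polynomial.X ^ 2
    + Polynomial.C (X 0 * X 1 * X 2 + X 0 * X 1 * X 3 + X 0 * X 2 * X 3 + X 1 * X 2 * X 3)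
      * Polynomial.X ^ 3 + Polynomial.C (X 0 * X 1 * X 2 * X 3) * Polynomial.X ^ 4 := by
  simp only [ePoly, ee1, ee2, map_add, map_mul, CharTwo.sub_eq_add]
  ring

theorem natDegree_ePoly : ePoly.natDegree ≤ 4 := by
  rw [ePoly_eq]; compute_degree

theorem exists_hom (S k m : ℕ) (hk : 4 ≤ k) (hm : S ≤ m) (hp0 : 0 < k) (hp1 : 1 < k) :
    ∃ Φ : GrassCoh k m →ₐ[ZMod 2] (P4 ⧸ idI (S + 4)),
      Φ (sw k m ⟨0, hp0⟩) = Ideal.Quotient.mk _ ee1 ∧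
      Φ (sw k m ⟨1, hp1⟩) = Ideal.Quotient.mk _ ee2 := by
  let q := Ideal.Quotient.mk (idI (S + 4))
  obtain ⟨Φ, hΦ⟩ := exists_grassHom (R := P4 ⧸ idI (S + 4)) k m
    (fun i => q (ePoly.coeff i)) (fun j => q (PowerSeries.coeff j hSer)) (by
      have h0 : (1 : Polynomial (P4 ⧸ idI (S + 4))) + ∑ i : Fin k,
          Polynomial.C (q (ePoly.coeff (i + 1))) * Polynomial.X ^ ((i : ℕ) + 1)
          = ePoly.map q := by
        rw [Fin.sum_univ_eq_sum_range (fun i : ℕ => Polynomial.C (q (ePoly.coeff (i + 1))) *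
          Polynomial.X ^ (i + 1)) k]
        ext1 d
        simp only [Polynomial.coeff_add, Polynomial.finsetSum_coeff, Polynomial.coeff_C_mul,
          Polynomial.coeff_X_pow, Polynomial.coeff_one, Polynomial.coeff_map]
        rcases d with _ | d
        · simp [ePoly_eq]
        · by_cases hd : d < k
          · rw [Finset.sum_eq_single d] <;> simp +contextual [hd]
            intro b _ hb hb'; omega
          · rw [Finset.sum_eq_zero, Polynomial.coeff_eq_zero_of_natDegree_lt]
            · simp
            · have := natDegree_ePoly; omega
            · intro x hx; simp at hx; rw [if_neg (by omega), mul_zero]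
      have h1 : (((1 : Polynomial (P4 ⧸ idI (S + 4))) + ∑ j : Fin m,
          Polynomial.C (q (PowerSeries.coeff (j + 1) hSer)) * Polynomial.X ^ ((j : ℕ) + 1) :
          Polynomial (P4 ⧸ idI (S + 4))) : PowerSeries (P4 ⧸ idI (S + 4)))
          = PowerSeries.map q hSer := by
        rw [Fin.sum_univ_eq_sum_range (fun i : ℕ => Polynomial.C (q (PowerSeries.coeff (i + 1) hSer)) *
          Polynomial.X ^ (i + 1)) m]
        ext1 d
        simp only [Polynomial.coeff_coe, Polynomial.coeff_add, Polynomial.finsetSum_coeff,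
          Polynomial.coeff_C_mul,
          Polynomial.coeff_X_pow, Polynomial.coeff_one, PowerSeries.coeff_map]
        rcases d with _ | d
        · simp [hSer, geo]
        · by_cases hd : d < m
          · rw [Finset.sum_eq_single d] <;> simp +contextual [hd]
            intro b _ hb hb'; omega
          · rw [Finset.sum_eq_zero, Ideal.Quotient.eq_zero_iff_mem.2 (hSer_mem S (d + 1) (by omega))]
            · simp
            · intro x hx; simp at hx; rw [if_neg (by omega), mul_zero]
      rw [h0]
      apply Polynomial.coe_injective
      rw [Polynomial.coe_mul, h1]
      have : ((ePoly.map q : Polynomial _) : PowerSeries (P4 ⧸ idI (S + 4))) =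
          PowerSeries.map q (ePoly : PowerSeries P4) := by
        ext; simp
      rw [this, ← map_mul, ePoly_hSer]; simp)
  refine ⟨Φ, ?_, ?_⟩
  · rw [hΦ]; congr 1; simp only [ePoly_eq, Polynomial.coeff_add, Polynomial.coeff_C_mul,
      Polynomial.coeff_X_pow, Polynomial.coeff_X, Polynomial.coeff_one]; simp
  · rw [hΦ]; congr 1; simp only [ePoly_eq, Polynomial.coeff_add, Polynomial.coeff_C_mul,
      Polynomial.coeff_X_pow, Polynomial.coeff_X, Polynomial.coeff_one]; simp

def mm (a b c d : ℕ) : Fin 4 →₀ ℕ := Finsupp.equivFunOnFinite.symm ![a, b, c, d]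

/-- coefficient functional -/
def cf (a b c d : ℕ) : P4 →ₗ[ZMod 2] ZMod 2 := lcoeff (ZMod 2) (mm a b c d)

theorem cf_X0 (a b c d n : ℕ) (f : P4) :
    cf a b c d (X 0 ^ n * f) = if n ≤ a then cf (a - n) b c d f else 0 := by
  have h1 : Finsupp.single 0 n ≤ mm a b c d ↔ n ≤ a := by
    rw [Finsupp.single_le_iff]; simp [mm]
  have h2 : mm a b c d - Finsupp.single 0 n = mm (a - n) b c d := by
    ext i; fin_cases i <;> simp [mm]
  simp only [cf, lcoeff_apply]
  rw [X_pow_eq_monomial, coeff_monomial_mul', h2, one_mul]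
  simp only [h1]

theorem cf_X1 (a b c d n : ℕ) (f : P4) :
    cf a b c d (X 1 ^ n * f) = if n ≤ b then cf a (b - n) c d f else 0 := by
  have h1 : Finsupp.single 1 n ≤ mm a b c d ↔ n ≤ b := by
    rw [Finsupp.single_le_iff]; simp [mm]
  have h2 : mm a b c d - Finsupp.single 1 n = mm a (b - n) c d := by
    ext i; fin_cases i <;> simp [mm]
  simp only [cf, lcoeff_apply]
  rw [X_pow_eq_monomial, coeff_monomial_mul', h2, one_mul]
  simp only [h1]

theorem cf_X2 (a b c d n : ℕ) (f : P4) :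
    cf a b c d (X 2 ^ n * f) = if n ≤ c then cf a b (c - n) d f else 0 := by
  have h1 : Finsupp.single 2 n ≤ mm a b c d ↔ n ≤ c := by
    rw [Finsupp.single_le_iff]; simp [mm]
  have h2 : mm a b c d - Finsupp.single 2 n = mm a b (c - n) d := by
    ext i; fin_cases i <;> simp [mm]
  simp only [cf, lcoeff_apply]
  rw [X_pow_eq_monomial, coeff_monomial_mul', h2, one_mul]
  simp only [h1]

theorem cf_X3 (a b c d n : ℕ) (f : P4) :
    cf a b c d (X 3 ^ n * f) = if n ≤ d then cf a b c (d - n) f else 0 := by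
  have h1 : Finsupp.single 3 n ≤ mm a b c d ↔ n ≤ d := by
    rw [Finsupp.single_le_iff]; simp [mm]
  have h2 : mm a b c d - Finsupp.single 3 n = mm a b c (d - n) := by
    ext i; fin_cases i <;> simp [mm]
  simp only [cf, lcoeff_apply]
  rw [X_pow_eq_monomial, coeff_monomial_mul', h2, one_mul]
  simp only [h1]

theorem cf_Y0 (a b c d : ℕ) (f : P4) :
    cf a b c d (X 0 * f) = if 1 ≤ a then cf (a - 1) b c d f else 0 := by
  simpa using cf_X0 a b c d 1 f

theorem cf_Y1 (a b c d : ℕ) (f : P4) :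
    cf a b c d (X 1 * f) = if 1 ≤ b then cf a (b - 1) c d f else 0 := by
  simpa using cf_X1 a b c d 1 f

theorem cf_Y2 (a b c d : ℕ) (f : P4) :
    cf a b c d (X 2 * f) = if 1 ≤ c then cf a b (c - 1) d f else 0 := by
  simpa using cf_X2 a b c d 1 f

theorem cf_Y3 (a b c d : ℕ) (f : P4) :
    cf a b c d (X 3 * f) = if 1 ≤ d then cf a b c (d - 1) f else 0 := by
  simpa using cf_X3 a b c d 1 f

theorem cf_one (a b c d : ℕ) :
    cf a b c d 1 = if a = 0 ∧ b = 0 ∧ c = 0 ∧ d = 0 then 1 else 0 := by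
  have : (0 = mm a b c d) ↔ (a = 0 ∧ b = 0 ∧ c = 0 ∧ d = 0) := by
    rw [DFunLike.ext_iff, Fin.forall_fin_succ, Fin.forall_fin_succ, Fin.forall_fin_succ,
      Fin.forall_fin_succ]
    simp [mm, eq_comm]
  simp only [cf, lcoeff_apply, coeff_one, this]

theorem vdm_eq : vdm = (X 0 + X 1) * ((X 0 + X 2) * ((X 0 + X 3) * ((X 1 + X 2) * ((X 1 + X 3) *
    ((X 2 + X 3) * 1))))) := by
  simp only [vdm, CharTwo.sub_eq_add, mul_one]

theorem ee1_pow (n : ℕ) : ee1 ^ 2 ^ n = X 0 ^ 2 ^ n + X 1 ^ 2 ^ n + X 2 ^ 2 ^ n + X 3 ^ 2 ^ n := by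
  simp only [ee1, add_pow_char_pow]

theorem ee2_pow (n : ℕ) : ee2 ^ 2 ^ n = X 0 ^ 2 ^ n * X 1 ^ 2 ^ n + X 0 ^ 2 ^ n * X 2 ^ 2 ^ n
    + X 0 ^ 2 ^ n * X 3 ^ 2 ^ n + X 1 ^ 2 ^ n * X 2 ^ 2 ^ n + X 1 ^ 2 ^ n * X 3 ^ 2 ^ n
    + X 2 ^ 2 ^ n * X 3 ^ 2 ^ n := by
  simp only [ee2, add_pow_char_pow, mul_pow]

-- concrete coefficients
theorem conc1 : cf 3 2 1 3 (ee1 * ((X 0 ^ 2 + X 1 ^ 2 + X 2 ^ 2 + X 3 ^ 2) * vdm)) = 0 := by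
  simp [ee1, vdm_eq, add_mul, mul_assoc, cf_X0, cf_X1, cf_X2, cf_X3, cf_Y0, cf_Y1, cf_Y2, cf_Y3, cf_one,
    -mul_one, -map_mul]
  try decide

theorem conc2 : cf 3 2 1 3 (ee1 * (ee2 * vdm)) = 0 := by
  simp [ee1, ee2, vdm_eq, add_mul, mul_assoc, cf_X0, cf_X1, cf_X2, cf_X3, cf_Y0, cf_Y1, cf_Y2, cf_Y3, cf_one,
    -mul_one, -map_mul]
  try decide

theorem conc3 : cf 3 2 1 7 (ee1 * ((X 0 ^ 2 + X 1 ^ 2 + X 2 ^ 2 + X 3 ^ 2) *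
    ((X 0 ^ 2 * X 1 ^ 2 + X 0 ^ 2 * X 2 ^ 2
    + X 0 ^ 2 * X 3 ^ 2 + X 1 ^ 2 * X 2 ^ 2 + X 1 ^ 2 * X 3 ^ 2
    + X 2 ^ 2 * X 3 ^ 2) * vdm))) = 0 := by
  simp [ee1, ee2, vdm_eq, add_mul, mul_assoc, cf_X0, cf_X1, cf_X2, cf_X3, cf_Y0, cf_Y1, cf_Y2, cf_Y3, cf_one,
    -mul_one, -map_mul]
  try decide

theorem conc4 : cf 3 2 1 7 (ee1 * (ee2 *
    ((X 0 ^ 2 * X 1 ^ 2 + X 0 ^ 2 * X 2 ^ 2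
    + X 0 ^ 2 * X 3 ^ 2 + X 1 ^ 2 * X 2 ^ 2 + X 1 ^ 2 * X 3 ^ 2
    + X 2 ^ 2 * X 3 ^ 2) * vdm))) = 1 := by
  simp [ee1, ee2, vdm_eq, add_mul, mul_assoc, cf_X0, cf_X1, cf_X2, cf_X3, cf_Y0, cf_Y1, cf_Y2, cf_Y3, cf_one,
    -mul_one, -map_mul]
  try decide

theorem conc5 : cf 4 3 5 0 ((X 0 ^ 4 + X 1 ^ 4 + X 2 ^ 4 + X 3 ^ 4) *
    ((X 0 ^ 2 + X 1 ^ 2 + X 2 ^ 2 + X 3 ^ 2) * vdm)) = 1 := by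
  simp [ee1, ee2, vdm_eq, add_mul, mul_assoc, cf_X0, cf_X1, cf_X2, cf_X3, cf_Y0, cf_Y1, cf_Y2, cf_Y3, cf_one,
    -mul_one, -map_mul]
  try decide

theorem conc6 : cf 8 7 5 0 ((X 2 ^ 4 * (X 0 ^ 4 + X 1 ^ 4) +
      X 3 ^ 4 * (X 0 ^ 4 + X 1 ^ 4 + X 2 ^ 4)) * ((X 0 ^ 4 + X 1 ^ 4 + X 2 ^ 4 + X 3 ^ 4) *
    ((X 0 ^ 2 + X 1 ^ 2 + X 2 ^ 2 + X 3 ^ 2) * vdm))) = 0 := by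
  simp [ee1, ee2, vdm_eq, add_mul, mul_assoc, cf_X0, cf_X1, cf_X2, cf_X3, cf_Y0, cf_Y1, cf_Y2, cf_Y3, cf_one,
    -mul_one, -map_mul]
  try decide

theorem vdm_split : ∃ A B : P4, vdm = X 0 * A + X 3 * B :=
  ⟨(X 0 + X 1) * ((X 0 + X 2) * ((X 1 + X 2) * ((X 1 + X 3) * (X 2 + X 3)))),
   (X 0 + X 1) * ((X 0 + X 2) * ((X 1 + X 2) * ((X 1 + X 3) * (X 2 + X 3)))), by
    rw [vdm_eq]; ring⟩

theorem left_zero1 (s i j : ℕ) (hs : 3 ≤ s) (hi : 2 ^ s ≤ i) :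
    cf (2 ^ s) (2 ^ s - 1) 5 0 (vdm * (ee1 ^ i * ee2 ^ j)) = 0 := by
  have h8 : 2 ^ 3 ≤ 2 ^ s := Nat.pow_le_pow_right (by norm_num) hs
  obtain ⟨c, rfl⟩ := Nat.exists_eq_add_of_le hi
  have : vdm * (ee1 ^ (2 ^ s + c) * ee2 ^ j) = ee1 ^ 2 ^ s * (vdm * (ee1 ^ c * ee2 ^ j)) := by ring
  rw [this, ee1_pow]
  simp only [add_mul, map_add, cf_X0, cf_X1, cf_X2, cf_X3]
  rw [if_pos le_rfl, if_neg (by omega), if_neg (by omega), if_neg (by omega)]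
  obtain ⟨A, B, hAB⟩ := vdm_split
  rw [hAB]
  simp [add_mul, mul_assoc, cf_Y0, cf_Y3]

theorem left_zero2 (s i j : ℕ) (hs : 3 ≤ s) (hj : 2 ^ s ≤ j) :
    cf (2 ^ s) (2 ^ s - 1) 5 0 (vdm * (ee1 ^ i * ee2 ^ j)) = 0 := by
  have h8 : 2 ^ 3 ≤ 2 ^ s := Nat.pow_le_pow_right (by norm_num) hs
  obtain ⟨c, rfl⟩ := Nat.exists_eq_add_of_le hj
  have : vdm * (ee1 ^ i * ee2 ^ (2 ^ s + c)) = ee2 ^ 2 ^ s * (vdm * (ee1 ^ i * ee2 ^ c)) := by ring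
  have h1 : ¬ (2 ^ s ≤ 2 ^ s - 1) := by omega
  have h2 : ¬ (2 ^ s ≤ 5) := by omega
  have h3 : ¬ (2 ^ s ≤ 0) := by omega
  rw [this, ee2_pow]
  simp only [add_mul, map_add, cf_X0, cf_X1, cf_X2, cf_X3, mul_assoc, if_neg h1, if_neg h2, if_neg h3]
  simp

theorem cf_homog (i j a b c d : ℕ) (h : i + 2 * j + 6 ≠ a + b + c + d) :
    cf a b c d (vdm * (ee1 ^ i * ee2 ^ j)) = 0 := by
  have hX : ∀ i : Fin 4, (X i : P4).IsHomogeneous 1 := fun i => isHomogeneous_X _ i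
  have h1 : ee1.IsHomogeneous 1 := (((hX 0).add (hX 1)).add (hX 2)).add (hX 3)
  have hXX : ∀ i j : Fin 4, (X i * X j : P4).IsHomogeneous 2 := fun i j => (hX i).mul (hX j)
  have h2 : ee2.IsHomogeneous 2 :=
    (((((hXX 0 1).add (hXX 0 2)).add (hXX 0 3)).add (hXX 1 2)).add (hXX 1 3)).add (hXX 2 3)
  have hS : ∀ i j : Fin 4, (X i - X j : P4).IsHomogeneous 1 := fun i j => (hX i).sub (hX j)
  have hv : vdm.IsHomogeneous 6 :=
    (hS 0 1).mul ((hS 0 2).mul ((hS 0 3).mul ((hS 1 2).mul ((hS 1 3).mul (hS 2 3)))))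
  have hh := hv.mul ((h1.pow i).mul (h2.pow j))
  apply hh.coeff_eq_zero
  rw [Finsupp.degree_eq_sum, Fin.sum_univ_four]
  simp [mm]
  omega

theorem left_one (s : ℕ) (hs : 3 ≤ s) :
    cf (2 ^ s) (2 ^ s - 1) 5 0 (vdm * (ee1 ^ 6 * ee2 ^ (2 ^ s - 4))) = 1 := by
  obtain ⟨u, rfl⟩ := Nat.exists_eq_add_of_le hs
  have hu : 1 ≤ 2 ^ u := Nat.one_le_two_pow
  obtain ⟨M, hM⟩ : ∃ M, 2 ^ (3 + u) = 4 * M + 8 := ⟨2 * (2 ^ u - 1), by rw [pow_add]; omega⟩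
  rw [hM]
  have e14 : ee1 ^ 4 = X 0 ^ 4 + X 1 ^ 4 + X 2 ^ 4 + X 3 ^ 4 := ee1_pow 2
  have e12 : ee1 ^ 2 = X 0 ^ 2 + X 1 ^ 2 + X 2 ^ 2 + X 3 ^ 2 := ee1_pow 1
  have e24 : ee2 ^ 4 = X 0 ^ 4 * X 1 ^ 4 + (X 2 ^ 4 * (X 0 ^ 4 + X 1 ^ 4) +
      X 3 ^ 4 * (X 0 ^ 4 + X 1 ^ 4 + X 2 ^ 4)) := by
    have h := ee2_pow 2
    rw [show (2 : ℕ) ^ 2 = 4 by norm_num] at h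
    rw [h]; ring
  set c : P4 := (X 2 ^ 4 * (X 0 ^ 4 + X 1 ^ 4) +
      X 3 ^ 4 * (X 0 ^ 4 + X 1 ^ 4 + X 2 ^ 4)) with hc
  have hc2 : c ^ 2 = X 2 ^ 8 * (X 0 ^ 4 + X 1 ^ 4) ^ 2 +
      X 3 ^ 8 * (X 0 ^ 4 + X 1 ^ 4 + X 2 ^ 4) ^ 2 := by
    rw [hc, CharTwo.add_sq]; ring
  obtain ⟨K, hK⟩ := Polynomial.powAddExpansion (X 0 ^ 4 * X 1 ^ 4 : P4) c (M + 1)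
  have h0 : (4 * M + 8 - 4) = 4 * (M + 1) := by omega
  set f : P4 := ((X 0 ^ 4 + X 1 ^ 4 + X 2 ^ 4 + X 3 ^ 4) *
    ((X 0 ^ 2 + X 1 ^ 2 + X 2 ^ 2 + X 3 ^ 2) * vdm)) with hf
  have key : vdm * (ee1 ^ 6 * ee2 ^ (4 * M + 8 - 4)) =
      X 0 ^ (4 * M + 4) * (X 1 ^ (4 * M + 4) * f) +
      X 0 ^ (4 * M) * (X 1 ^ (4 * M) * ((M + 1) • (c * f))) +
      (X 2 ^ 8 * ((X 0 ^ 4 + X 1 ^ 4) ^ 2 * (K * f)) +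
      X 3 ^ 8 * ((X 0 ^ 4 + X 1 ^ 4 + X 2 ^ 4) ^ 2 * (K * f))) := by
    rw [h0, pow_mul, e24, hK, hc2, show ee1 ^ 6 = ee1 ^ 4 * ee1 ^ 2 by ring, e14, e12, hf,
      nsmul_eq_mul]
    rw [Nat.add_sub_cancel]
    ring
  rw [key]
  simp only [map_add, cf_X0, cf_X1, cf_X2, cf_X3, map_nsmul]
  rw [if_pos (by omega), if_pos (by omega), if_pos (by omega), if_pos (by omega),
    if_neg (by omega), if_neg (by omega)]
  rw [show 4 * M + 8 - (4 * M + 4) = 4 by omega, show 4 * M + 8 - 1 - (4 * M + 4) = 3 by omega,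
    show 4 * M + 8 - 4 * M = 8 by omega, show 4 * M + 8 - 1 - 4 * M = 7 by omega, hf, conc5,
    hc, conc6]
  simp

theorem right_reduce (s p q : ℕ) (hs : 3 ≤ s) :
    cf (2 ^ s + 3) (2 ^ s + 2) (2 ^ s + 1) (2 ^ s - 1)
      (vdm * (ee1 ^ (2 ^ s + p) * ee2 ^ (2 ^ s + q))) =
    cf 3 2 1 (2 ^ s - 1) (vdm * (ee1 ^ p * ee2 ^ q)) := by
  have h8 : 2 ^ 3 ≤ 2 ^ s := Nat.pow_le_pow_right (by norm_num) hs
  set f := vdm * (ee1 ^ p * ee2 ^ q) with hf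
  have h2 : (2 : P4) = 0 := CharTwo.two_eq_zero
  have key : vdm * (ee1 ^ (2 ^ s + p) * ee2 ^ (2 ^ s + q)) =
      X 0 ^ 2 ^ s * (X 1 ^ 2 ^ s * (X 2 ^ 2 ^ s * f)) +
      (X 0 ^ 2 ^ s * (X 0 ^ 2 ^ s * ((X 1 ^ 2 ^ s + X 2 ^ 2 ^ s) * f)) +
      X 1 ^ 2 ^ s * (X 1 ^ 2 ^ s * ((X 0 ^ 2 ^ s + X 2 ^ 2 ^ s) * f)) +
      X 2 ^ 2 ^ s * (X 2 ^ 2 ^ s * ((X 0 ^ 2 ^ s + X 1 ^ 2 ^ s) * f))) +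
      X 3 ^ 2 ^ s * (((X 0 ^ 2 ^ s * X 1 ^ 2 ^ s + X 0 ^ 2 ^ s * X 2 ^ 2 ^ s +
        X 1 ^ 2 ^ s * X 2 ^ 2 ^ s) + (X 0 ^ 2 ^ s + X 1 ^ 2 ^ s + X 2 ^ 2 ^ s + X 3 ^ 2 ^ s) *
          (X 0 ^ 2 ^ s + X 1 ^ 2 ^ s + X 2 ^ 2 ^ s)) * f) := by
    rw [pow_add ee1, pow_add ee2, ee1_pow, ee2_pow, hf]
    generalize (X 0 : P4) ^ 2 ^ s = x0
    generalize (X 1 : P4) ^ 2 ^ s = x1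
    generalize (X 2 : P4) ^ 2 ^ s = x2
    generalize (X 3 : P4) ^ 2 ^ s = x3
    linear_combination (x0 * x1 * x2 * (vdm * (ee1 ^ p * ee2 ^ q))) * h2
  rw [key]
  simp only [map_add, cf_X0, cf_X1, cf_X2, cf_X3]
  have h1 : ¬ (2 ^ s ≤ 2 ^ s - 1) := by omega
  simp only [if_neg h1, Nat.add_sub_cancel_left, if_neg (show ¬ (2 ^ s ≤ 3) by omega),
    if_neg (show ¬ (2 ^ s ≤ 2) by omega), if_neg (show ¬ (2 ^ s ≤ 1) by omega)]
  simp

theorem right_e1 (a d : ℕ) (f : P4) : cf 3 2 1 (4 * a + d) (ee1 ^ (4 * a) * f) = cf 3 2 1 d f := by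
  induction a generalizing f with
  | zero => simp
  | succ a ih =>
    have e14 : ee1 ^ 4 = X 0 ^ 4 + X 1 ^ 4 + X 2 ^ 4 + X 3 ^ 4 := ee1_pow 2
    have : ee1 ^ (4 * (a + 1)) * f = (X 0 ^ 4 + X 1 ^ 4 + X 2 ^ 4 + X 3 ^ 4) * (ee1 ^ (4 * a) * f) := by
      rw [← e14]; ring
    rw [this]
    simp only [add_mul, map_add, cf_X0, cf_X1, cf_X2, cf_X3]
    rw [if_neg (by norm_num), if_neg (by norm_num), if_neg (by norm_num), if_pos (by omega),
      show 4 * (a + 1) + d - 4 = 4 * a + d by omega, ih]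
    simp

theorem right_big (d p q : ℕ) (hq : 4 ≤ q) : cf 3 2 1 d (vdm * (ee1 ^ p * ee2 ^ q)) = 0 := by
  obtain ⟨c, rfl⟩ := Nat.exists_eq_add_of_le hq
  have e24 : ee2 ^ 2 ^ 2 = _ := ee2_pow 2
  have : vdm * (ee1 ^ p * ee2 ^ (4 + c)) = ee2 ^ 2 ^ 2 * (vdm * (ee1 ^ p * ee2 ^ c)) := by ring
  rw [this, e24]
  simp [add_mul, mul_assoc, cf_X0, cf_X1, cf_X2, cf_X3]

theorem right_small (s p q : ℕ) (hs : 3 ≤ s) (hpq : p + 2 * q = 2 ^ s - 1) :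
    cf 3 2 1 (2 ^ s - 1) (vdm * (ee1 ^ p * ee2 ^ q)) = if q = 3 then 1 else 0 := by
  by_cases hq : 4 ≤ q
  · rw [right_big _ _ _ hq, if_neg (by omega)]
  obtain ⟨u, rfl⟩ := Nat.exists_eq_add_of_le hs
  have hu : 1 ≤ 2 ^ u := Nat.one_le_two_pow
  obtain ⟨M, hM⟩ : ∃ M, 2 ^ (3 + u) = 4 * M + 8 := ⟨2 * (2 ^ u - 1), by rw [pow_add]; omega⟩
  rw [hM] at hpq ⊢
  have e12 : ee1 ^ 2 = X 0 ^ 2 + X 1 ^ 2 + X 2 ^ 2 + X 3 ^ 2 := ee1_pow 1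
  have e22 : ee2 ^ 2 = _ := ee2_pow 1
  simp only [pow_one] at e22
  have hq' : q = 0 ∨ q = 1 ∨ q = 2 ∨ q = 3 := by omega
  rcases hq' with rfl | rfl | rfl | rfl
  · obtain rfl : p = 4 * (M + 1) + 3 := by omega
    rw [show 4 * M + 8 - 1 = 4 * (M + 1) + 3 by omega,
      show vdm * (ee1 ^ (4 * (M + 1) + 3) * ee2 ^ 0) = ee1 ^ (4 * (M + 1)) * (ee1 * (ee1 ^ 2 * vdm))
        by ring, right_e1, e12, conc1]
    simp
  · obtain rfl : p = 4 * (M + 1) + 1 := by omega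
    rw [show 4 * M + 8 - 1 = 4 * (M + 1) + 3 by omega,
      show vdm * (ee1 ^ (4 * (M + 1) + 1) * ee2 ^ 1) = ee1 ^ (4 * (M + 1)) * (ee1 * (ee2 * vdm))
        by ring, right_e1, conc2]
    simp
  · obtain rfl : p = 4 * M + 3 := by omega
    rw [show 4 * M + 8 - 1 = 4 * M + 7 by omega,
      show vdm * (ee1 ^ (4 * M + 3) * ee2 ^ 2) =
        ee1 ^ (4 * M) * (ee1 * (ee1 ^ 2 * (ee2 ^ 2 * vdm)))
        by ring, right_e1, e12, e22, conc3]
    simp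
  · obtain rfl : p = 4 * M + 1 := by omega
    rw [show 4 * M + 8 - 1 = 4 * M + 7 by omega,
      show vdm * (ee1 ^ (4 * M + 1) * ee2 ^ 3) =
        ee1 ^ (4 * M) * (ee1 * (ee2 * (ee2 ^ 2 * vdm)))
        by ring, right_e1, e22, conc4]
    simp

/-- The total pairing. -/
theorem pairing (s i j : ℕ) (hs : 3 ≤ s) (hi : i < 2 ^ (s + 1)) (hj : j < 2 ^ (s + 1)) :
    cf (2 ^ s) (2 ^ s - 1) 5 0 (vdm * (ee1 ^ i * ee2 ^ j)) *
    cf (2 ^ s + 3) (2 ^ s + 2) (2 ^ s + 1) (2 ^ s - 1)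
      (vdm * (ee1 ^ (2 ^ (s + 1) - 1 - i) * ee2 ^ (2 ^ (s + 1) - 1 - j))) =
    if i = 6 ∧ j = 2 ^ s - 4 then 1 else 0 := by
  have h8 : 2 ^ 3 ≤ 2 ^ s := Nat.pow_le_pow_right (by norm_num) hs
  have hp : 2 ^ (s + 1) = 2 ^ s + 2 ^ s := by ring
  by_cases h1 : 2 ^ s ≤ i
  · rw [left_zero1 s i j hs h1, zero_mul, if_neg (by omega)]
  by_cases h2 : 2 ^ s ≤ j
  · rw [left_zero2 s i j hs h2, zero_mul, if_neg (by omega)]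
  by_cases h3 : i + 2 * j + 6 = 2 ^ s + (2 ^ s - 1) + 5 + 0
  · rw [show 2 ^ (s + 1) - 1 - i = 2 ^ s + (2 ^ s - 1 - i) by omega,
      show 2 ^ (s + 1) - 1 - j = 2 ^ s + (2 ^ s - 1 - j) by omega, right_reduce _ _ _ hs,
      right_small _ _ _ hs (by omega)]
    by_cases h4 : j = 2 ^ s - 4
    · obtain rfl : i = 6 := by omega
      rw [h4, left_one s hs, if_pos (by omega), if_pos (by omega), one_mul]
    · rw [if_neg (by omega), if_neg (by omega), mul_zero]
  · rw [cf_homog _ _ _ _ _ _ h3, zero_mul, if_neg (by omega)]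

theorem exists_functional (N a b c d : ℕ) (ha : a < N) (hb : b < N) (hc : c < N) (hd : d < N) :
    ∃ L : (P4 ⧸ idI N) →ₗ[ZMod 2] ZMod 2,
      ∀ f : P4, L (Ideal.Quotient.mk _ f) = cf a b c d (vdm * f) := by
  let φ : P4 →ₗ[ZMod 2] ZMod 2 := cf a b c d ∘ₗ LinearMap.mulLeft (ZMod 2) vdm
  have hφ : ∀ f ∈ idI N, φ f = 0 := by
    intro f hf
    rw [mem_idI, idJ, mem_ideal_span_monomial_image] at hf
    change coeff (mm a b c d) (vdm * f) = 0
    by_contra hne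
    obtain ⟨_, ⟨i, rfl⟩, hi⟩ := hf _ (mem_support_iff.2 hne)
    rw [Finsupp.single_le_iff] at hi
    fin_cases i <;> simp [mm] at hi <;> omega
  let g : (P4 ⧸ idI N) →+ ZMod 2 :=
    QuotientAddGroup.lift (idI N).toAddSubgroup φ.toAddMonoidHom (fun f hf => hφ f hf)
  refine ⟨g.toZModLinearMap 2, fun f => rfl⟩

theorem add_pow_all {R : Type} [CommRing R] [Algebra (ZMod 2) R] (x y : R) (n : ℕ) :
    (x + y) ^ (2 ^ n - 1) = ∑ i ∈ Finset.range (2 ^ n), x ^ i * y ^ (2 ^ n - 1 - i) := by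
  have hu : (X 0 + X 1 : MvPolynomial (Fin 2) (ZMod 2)) ^ (2 ^ n - 1) =
      ∑ i ∈ Finset.range (2 ^ n), X 0 ^ i * X 1 ^ (2 ^ n - 1 - i) := by
    have hne : (X 0 + X 1 : MvPolynomial (Fin 2) (ZMod 2)) ≠ 0 := by
      intro h
      have := congrArg (MvPolynomial.eval ![1, 0]) h
      simp at this
    apply mul_right_cancel₀ hne
    rw [← pow_succ, Nat.sub_add_cancel Nat.one_le_two_pow, add_pow_char_pow]
    have := (Commute.all (X 0 : MvPolynomial (Fin 2) (ZMod 2)) (X 1)).geom_sum₂_mul (2 ^ n)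
    rw [CharTwo.sub_eq_add, CharTwo.sub_eq_add] at this
    exact this.symm
  have := congrArg (MvPolynomial.aeval (R := ZMod 2) ![x, y]) hu
  simpa using this


theorem expand_prod {A : Type} [CommRing A] [Algebra (ZMod 2) A] (x y : A) (n : ℕ) :
    (x ⊗ₜ[ZMod 2] (1 : A) + (1 : A) ⊗ₜ[ZMod 2] x) ^ (2 ^ n - 1) *
      (y ⊗ₜ[ZMod 2] (1 : A) + (1 : A) ⊗ₜ[ZMod 2] y) ^ (2 ^ n - 1) =
    ∑ i ∈ Finset.range (2 ^ n), ∑ j ∈ Finset.range (2 ^ n),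
      (x ^ i * y ^ j) ⊗ₜ[ZMod 2] (x ^ (2 ^ n - 1 - i) * y ^ (2 ^ n - 1 - j)) := by
  rw [add_pow_all, add_pow_all, Finset.sum_mul_sum]
  simp only [Algebra.TensorProduct.tmul_pow, Algebra.TensorProduct.tmul_mul_tmul, one_pow,
      one_mul, mul_one]


theorem zd_mem_ker (k m : ℕ) (x : GrassCoh k m) : zd k m x ∈ LinearMap.ker (grassMul k m) := by
  rw [LinearMap.mem_ker, grassMul, zd, map_add, LinearMap.mul'_apply, LinearMap.mul'_apply,
    mul_one, one_mul, ← two_smul (ZMod 2) x, show (2 : ZMod 2) = 0 from rfl, zero_smul]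

theorem product_ne_zero (s k m : ℕ) (hk4 : 4 ≤ k) (hs : 3 ≤ s) (hm : 2 ^ s ≤ m)
    (hp0 : 0 < k) (hp1 : 1 < k) :
    zd k m (sw k m ⟨0, hp0⟩) ^ (2 ^ (s + 1) - 1) *
      zd k m (sw k m ⟨1, hp1⟩) ^ (2 ^ (s + 1) - 1) ≠ 0 := by
  have h8 : 2 ^ 3 ≤ 2 ^ s := Nat.pow_le_pow_right (by norm_num) hs
  have hp : 2 ^ (s + 1) = 2 ^ s + 2 ^ s := by ring
  obtain ⟨Φ, hΦ1, hΦ2⟩ := exists_hom (2 ^ s) k m hk4 hm hp0 hp1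
  obtain ⟨L1, hL1⟩ := exists_functional (2 ^ s + 4) (2 ^ s) (2 ^ s - 1) 5 0
    (by omega) (by omega) (by omega) (by omega)
  obtain ⟨L2, hL2⟩ := exists_functional (2 ^ s + 4) (2 ^ s + 3) (2 ^ s + 2) (2 ^ s + 1) (2 ^ s - 1)
    (by omega) (by omega) (by omega) (by omega)
  intro h0
  let T : GrassCoh k m ⊗[ZMod 2] GrassCoh k m →ₗ[ZMod 2] ZMod 2 :=
    LinearMap.mul' (ZMod 2) (ZMod 2) ∘ₗ
      TensorProduct.map (L1 ∘ₗ Φ.toLinearMap) (L2 ∘ₗ Φ.toLinearMap)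
  have hT : ∀ x y, T (x ⊗ₜ y) = L1 (Φ x) * L2 (Φ y) := fun x y => rfl
  generalize hw1 : sw k m ⟨0, _⟩ = w1 at h0 hΦ1
  generalize hw2 : sw k m ⟨1, _⟩ = w2 at h0 hΦ2
  have hval : ∀ i j : ℕ, Φ (w1 ^ i * w2 ^ j) = Ideal.Quotient.mk _ (ee1 ^ i * ee2 ^ j) := by
    intro i j
    rw [map_mul, map_pow, map_pow, hΦ1, hΦ2, map_mul, map_pow, map_pow]
  have h1 := congrArg T h0
  have hz : zd k m w1 ^ (2 ^ (s + 1) - 1) * zd k m w2 ^ (2 ^ (s + 1) - 1) = _ :=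
    expand_prod w1 w2 (s + 1)
  rw [hz, map_zero] at h1
  simp only [map_sum, hT, hval, hL1, hL2] at h1
  rw [Finset.sum_congr rfl (fun i hi => Finset.sum_congr rfl (fun j hj =>
    pairing s i j hs (Finset.mem_range.1 hi) (Finset.mem_range.1 hj)))] at h1
  rw [Finset.sum_eq_single 6, Finset.sum_eq_single (2 ^ s - 4)] at h1
  · simp at h1
  · intro j _ hj
    rw [if_neg (by tauto)]
  · intro h
    exact absurd (Finset.mem_range.2 (by omega)) h
  · intro i _ hi
    exact Finset.sum_eq_zero fun j _ => if_neg (by tauto)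
  · intro h
    exact absurd (Finset.mem_range.2 (by omega)) h

/-- For `4 ≤ k ≤ 2^{s-1}` and `2^s + k ≤ n ≤ 2^{s+1}`: in `A(k,n) ⊗ A(k,n)` the product
`z(w_1)^{2^{s+1}-1} · z(w_2)^{2^{s+1}-1}` is nonzero; hence `zcl(k,n) ≥ 4·2^s - 2`. -/
theorem gkn_zcl_lb1 (s k n : ℕ) (hk4 : 4 ≤ k) (hk : k ≤ 2 ^ (s - 1))
    (hn1 : 2 ^ s + k ≤ n) (hn2 : n ≤ 2 ^ (s + 1)) :
    zd k (n - k) (sw k (n - k) ⟨0, by omega⟩) ^ (2 ^ (s + 1) - 1) *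
      zd k (n - k) (sw k (n - k) ⟨1, by omega⟩) ^ (2 ^ (s + 1) - 1) ≠ 0 ∧
    4 * 2 ^ s - 2 ∈ zclSet k (n - k) := by
  have hs : 3 ≤ s := by
    by_contra h
    have : 2 ^ (s - 1) ≤ 2 ^ 1 := Nat.pow_le_pow_right (by norm_num) (by omega)
    omega
  have hne := product_ne_zero s k (n - k) hk4 hs (by omega) (by omega) (by omega)
  refine ⟨hne, ?_⟩
  have hpos : 1 ≤ 2 ^ s := Nat.one_le_two_pow
  have hr : 4 * 2 ^ s - 2 = (2 ^ (s + 1) - 1) + (2 ^ (s + 1) - 1) := by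
    rw [pow_succ]; omega
  rw [hr]
  refine ⟨Fin.append (fun _ => zd k (n - k) (sw k (n - k) ⟨0, by omega⟩))
    (fun _ => zd k (n - k) (sw k (n - k) ⟨1, by omega⟩)), ?_, ?_⟩
  · intro i
    refine Fin.addCases (fun i => ?_) (fun i => ?_) i
    · rw [Fin.append_left]; exact zd_mem_ker _ _ _
    · rw [Fin.append_right]; exact zd_mem_ker _ _ _
  · rw [Fin.prod_univ_add]
    simp only [Fin.append_left, Fin.append_right, Finset.prod_const, Finset.card_univ,
      Fintype.card_fin]
    exact hne
end
end

section
/- Let k ≥ 3 and s ≥ 0 be integers, and let σ_1, σ_2, σ_3 denote the elementary symmetric polynomials of degrees 1, 2, 3 in the variables e_1, …, e_k over ℤ/2. Then in the quotient ring (ℤ/2)[e_1,…,e_k] / (e_1^{2^{s+1}}, …, e_k^{2^{s+1}}) one has the identity σ_1^{2^s} · σ_2^{2^s} = σ_3^{2^s}. -/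
open MvPolynomial

noncomputable section

/-- The Newton identity in degree three, over the field with two elements. -/
lemma newton_three (k : ℕ) : esymm (Fin k) (ZMod 2) 1 * esymm (Fin k) (ZMod 2) 2 =
    esymm (Fin k) (ZMod 2) 3 + (esymm (Fin k) (ZMod 2) 1 * psum (Fin k) (ZMod 2) 2 +
      psum (Fin k) (ZMod 2) 3) := by
  have h := MvPolynomial.mul_esymm_eq_sum (Fin k) (ZMod 2) 3
  have hf : (Finset.HasAntidiagonal.antidiagonal 3).filter (fun a : ℕ × ℕ => a.1 < 3) =
      {(0, 3), (1, 2), (2, 1)} := by decide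
  have hp : psum (Fin k) (ZMod 2) 1 = esymm (Fin k) (ZMod 2) 1 := by
    rw [psum_one, esymm_one]
  have h2 : (2 : MvPolynomial (Fin k) (ZMod 2)) = 0 := CharTwo.two_eq_zero
  rw [hf, Finset.sum_insert (by decide), Finset.sum_insert (by decide),
    Finset.sum_singleton] at h
  simp only [esymm_zero, hp] at h
  push_cast at h
  linear_combination -h + (esymm (Fin k) (ZMod 2) 3 -
    psum (Fin k) (ZMod 2) 3) * h2

lemma psum_pow_mem (k s n : ℕ) (hn : 2 ≤ n) :
    psum (Fin k) (ZMod 2) n ^ 2 ^ s ∈ Ideal.span { p : MvPolynomial (Fin k) (ZMod 2) |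
        ∃ i : Fin k, p = X i ^ 2 ^ (s + 1) } := by
  rw [psum, sum_pow_char_pow 2 s]
  refine Ideal.sum_mem _ fun i _ => ?_
  refine Ideal.mem_of_dvd _ ?_ (Ideal.subset_span ⟨i, rfl⟩)
  rw [← pow_mul]
  refine pow_dvd_pow _ ?_
  rw [pow_succ, mul_comm]
  exact Nat.mul_le_mul_right _ hn

/-- For `k ≥ 3`, `s ≥ 0`: in `(ℤ/2)[e_1,…,e_k] / (e_1^{2^{s+1}}, …, e_k^{2^{s+1}})` the
elementary symmetric polynomials satisfy `σ_1^{2^s} · σ_2^{2^s} = σ_3^{2^s}`. -/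
theorem esymm_identity (k s : ℕ) (hk : 3 ≤ k) :
    (Ideal.Quotient.mk (Ideal.span { p : MvPolynomial (Fin k) (ZMod 2) |
        ∃ i : Fin k, p = X i ^ 2 ^ (s + 1) })
        (esymm (Fin k) (ZMod 2) 1)) ^ 2 ^ s *
      (Ideal.Quotient.mk (Ideal.span { p : MvPolynomial (Fin k) (ZMod 2) |
        ∃ i : Fin k, p = X i ^ 2 ^ (s + 1) })
        (esymm (Fin k) (ZMod 2) 2)) ^ 2 ^ s =
      (Ideal.Quotient.mk (Ideal.span { p : MvPolynomial (Fin k) (ZMod 2) |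
        ∃ i : Fin k, p = X i ^ 2 ^ (s + 1) })
        (esymm (Fin k) (ZMod 2) 3)) ^ 2 ^ s := by
  rw [← mul_pow, ← map_mul, ← map_pow, ← map_pow, Ideal.Quotient.eq, newton_three,
    add_pow_char_pow, add_pow_char_pow, add_sub_cancel_left, mul_pow]
  exact Ideal.add_mem _ (Ideal.mul_mem_left _ _ (psum_pow_mem k s 2 le_rfl))
    (psum_pow_mem k s 3 (by norm_num))
end
end
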